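/- Let I = (V,E,Q,Φ) and I' = (V,E',Q,Φ') be MRF instances on the same vertex set with n = |V|, where φ'_a = φ_a for all a ∈ V ∪ (E∩E'), and |E ⊕ E'| ≤ L. Assume I' satisfies the Dobrushin–Shlosman condition with constant δ ∈ (0,1], and let Δ = max{Δ_G, Δ_{G'}} ≥ 1 be the maximum of the maximum degrees of G = (V,E) and G' = (V,E'). Run the one-step local coupling for edge update for T steps from X_0 = Y_0, let S = ∪_{{u,v}∈E⊕E'}{u,v}, D_t = {v : X_t(v) ≠ Y_t(v)}, and R_gra = Σ_{t=1}^T 1{v_t ∈ S ∪ Γ_G⁺(D_{t−1})}, where Γ_G⁺(D) = D ∪ Γ_G(D). Then E[R_gra] ≤ 18·Δ·T·L/(δ·n); in particular E[R_gra] = O(ΔTL/(nδ)). -/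

import Mathlib

open Finset
open scoped ENNReal

/-- Exponential on `ℝ ∪ {−∞}` (modeled as `WithBot ℝ`), with `exp(−∞) = 0`. -/
noncomputable def expB (x : WithBot ℝ) : ℝ := WithBot.recBotCoe 0 Real.exp x

/-- Total variation distance between two distributions on a finite set. -/
noncomputable def tvDist {Q : Type*} [Fintype Q] (μ ν : Q → ℝ) : ℝ :=
  2⁻¹ * ∑ x, |μ x - ν x|

/-- `D` is a coupling of the distributions `μ` and `ν` on a finite set. -/
def IsCoupling {Q : Type*} [Fintype Q] (μ ν : Q → ℝ) (D : Q → Q → ℝ) : Prop :=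
  (∀ c c', 0 ≤ D c c') ∧ (∀ c, ∑ c', D c c' = μ c) ∧ (∀ c', ∑ c, D c c' = ν c')

/-- `D` is an optimal coupling of `μ` and `ν`: a coupling maximizing the probability
of agreement of the two coordinates. -/
def IsOptimalCoupling {Q : Type*} [Fintype Q] (μ ν : Q → ℝ) (D : Q → Q → ℝ) : Prop :=
  IsCoupling μ ν D ∧
    ∀ D' : Q → Q → ℝ, IsCoupling μ ν D' → ∑ c, D' c c ≤ ∑ c, D c c

/-- Distribution of a finite-state Markov chain with transition kernel `P` after `t` steps,
started from the initial distribution `init`. -/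
noncomputable def chainDist {S : Type*} [Fintype S] (P : S → S → ℝ) (init : S → ℝ) :
    ℕ → S → ℝ
  | 0 => init
  | t + 1 => fun s' => ∑ s, chainDist P init t s * P s s'

/-- Point mass at `s0`. -/
noncomputable def initDelta {S : Type*} [DecidableEq S] (s0 : S) : S → ℝ :=
  fun s => if s = s0 then 1 else 0

/-- Transition kernel of a coupled pair of single-site (Gibbs-sampling style) chains:
a uniformly random vertex `v` is picked, all other coordinates of both copies are copied,
and the pair of new values at `v` is drawn from the local coupling `Dloc v`. -/
noncomputable def pairKernel {V Q : Type*} [Fintype V] [Fintype Q]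
    (Dloc : V → (V → Q) → (V → Q) → Q → Q → ℝ)
    (p p' : (V → Q) × (V → Q)) : ℝ := by
  classical
  exact (Fintype.card V : ℝ)⁻¹ * ∑ v,
    (if (∀ u, u ≠ v → p'.1 u = p.1 u) ∧ (∀ u, u ≠ v → p'.2 u = p.2 u)
      then Dloc v p.1 p.2 (p'.1 v) (p'.2 v) else 0)

/-- The resampling probability `p(c)` used in the local coupling for Hamiltonian update. -/
noncomputable def pResample {Q : Type*} (μ μ' : Q → ℝ) (c : Q) : ℝ := by
  classical
  exact if μ c ≤ μ' c then 0 else (μ c - μ' c) / μ c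

/-- The resampling distribution `ν` used in the local coupling for Hamiltonian update. -/
noncomputable def nuResample {Q : Type*} [Fintype Q] (μ μ' : Q → ℝ) (b : Q) : ℝ :=
  max 0 (μ' b - μ b) / ∑ x, max 0 (μ x - μ' x)

/-- The joint law of the local coupling for Hamiltonian update: first `(c,c')` is drawn from
the optimal coupling `Dopt`, then with probability `pResample μ μ' c'` the second coordinate
is resampled from `nuResample μ μ'`. -/
noncomputable def hamCoupling {Q : Type*} [Fintype Q] (μ μ' : Q → ℝ)
    (Dopt : Q → Q → ℝ) (c d : Q) : ℝ :=
  Dopt c d * (1 - pResample μ μ' d) +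
    nuResample μ μ' d * ∑ c', Dopt c c' * pResample μ μ' c'

/-- Indicator (as a real number) of the event `v ∈ Γ⁺(D)`, where `D` is the set of
disagreements between the two coordinates of the pair state `p`. -/
noncomputable def indNbr {V Q : Type*} [Fintype V] (G : SimpleGraph V)
    (p : (V → Q) × (V → Q)) (v : V) : ℝ := by
  classical
  exact if (∃ u, (u = v ∨ G.Adj v u) ∧ p.1 u ≠ p.2 u) then 1 else 0

/-- `v` is incident to an edge of the symmetric difference of the edge sets of `G` and `G'`. -/
def inS {V : Type*} (G G' : SimpleGraph V) (v : V) : Prop :=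
  ∃ u, (G.Adj v u ∧ ¬ G'.Adj v u) ∨ (G'.Adj v u ∧ ¬ G.Adj v u)

/-- Indicator (as a real number) of the event `v ∈ S ∪ Γ_G⁺(D)`. -/
noncomputable def indSnbr {V Q : Type*} [Fintype V] (G G' : SimpleGraph V)
    (p : (V → Q) × (V → Q)) (v : V) : ℝ := by
  classical
  exact if inS G G' v ∨ (∃ u, (u = v ∨ G.Adj v u) ∧ p.1 u ≠ p.2 u) then 1 else 0

/-- Conditional marginal distribution `μ_{v,I}(·|τ)` of the MRF at vertex `v` given the
configuration `τ` on its neighborhood, where the MRF on the graph `G` has vertex potentials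
`φ` and (symmetric) edge potentials `ψ` with values in `ℝ ∪ {−∞}`. -/
noncomputable def margW {V Q : Type*} [Fintype V] [Fintype Q]
    (G : SimpleGraph V) [DecidableRel G.Adj]
    (φ : V → Q → WithBot ℝ) (ψ : V → V → Q → Q → WithBot ℝ)
    (v : V) (τ : V → Q) (c : Q) : ℝ :=
  expB (φ v c + ∑ u ∈ G.neighborFinset v, ψ u v (τ u) c) /
    ∑ a, expB (φ v a + ∑ u ∈ G.neighborFinset v, ψ u v (τ u) a)

/-- The influence matrix `A_I(u,v)`: the largest total variation distance between the
conditional marginals at `v` induced by two boundary configurations differing only at `u`,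
when `{u,v}` is an edge, and `0` otherwise. -/
noncomputable def influence {V Q : Type*} [Fintype V] [Fintype Q]
    (G : SimpleGraph V) [DecidableRel G.Adj]
    (φ : V → Q → WithBot ℝ) (ψ : V → V → Q → Q → WithBot ℝ) (u v : V) : ℝ := by
  classical
  exact if G.Adj u v then
      sSup {d : ℝ | ∃ σ τ : V → Q, (∀ w, w ≠ u → σ w = τ w) ∧
        d = tvDist (margW G φ ψ v σ) (margW G φ ψ v τ)}
    else 0

/-- The Dobrushin–Shlosman condition with constant `δ`. -/
def DobrushinCondition {V Q : Type*} [Fintype V] [Fintype Q]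
    (G : SimpleGraph V) [DecidableRel G.Adj]
    (φ : V → Q → WithBot ℝ) (ψ : V → V → Q → Q → WithBot ℝ) (δ : ℝ) : Prop :=
  ∀ u : V, ∑ v, influence G φ ψ u v ≤ 1 - δ

/-- The transition kernel of the Gibbs sampling (Glauber dynamics) chain on the MRF:
a uniformly random vertex is picked and its spin resampled from the conditional marginal. -/
noncomputable def gibbsStep {V Q : Type*} [Fintype V] [Fintype Q]
    (G : SimpleGraph V) [DecidableRel G.Adj]
    (φ : V → Q → WithBot ℝ) (ψ : V → V → Q → Q → WithBot ℝ)
    (σ σ' : V → Q) : ℝ := by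
  classical
  exact (Fintype.card V : ℝ)⁻¹ *
    ∑ v, (if ∀ u, u ≠ v → σ' u = σ u then margW G φ ψ v σ (σ' v) else 0)

/-- Unnormalized Gibbs weight `exp(H(σ))` of a configuration. -/
noncomputable def gibbsWeight {V Q : Type*} [Fintype V] [DecidableEq V] [Fintype Q]
    (G : SimpleGraph V) [DecidableRel G.Adj] [Fintype G.edgeSet]
    (φ : V → Q → WithBot ℝ) (ψ : V → V → Q → Q → WithBot ℝ)
    (hψsym : ∀ u v c c', ψ u v c c' = ψ v u c' c) (σ : V → Q) : ℝ :=
  expB ((∑ v, φ v (σ v)) +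
    ∑ e ∈ G.edgeFinset,
      Sym2.lift ⟨fun u w => ψ u w (σ u) (σ w), fun u w => hψsym u w (σ u) (σ w)⟩ e)

/-- The Gibbs distribution `μ_I` of the MRF. -/
noncomputable def gibbsMeasure {V Q : Type*} [Fintype V] [DecidableEq V] [Fintype Q]
    (G : SimpleGraph V) [DecidableRel G.Adj] [Fintype G.edgeSet]
    (φ : V → Q → WithBot ℝ) (ψ : V → V → Q → Q → WithBot ℝ)
    (hψsym : ∀ u v c c', ψ u v c c' = ψ v u c' c) (σ : V → Q) : ℝ :=
  gibbsWeight G φ ψ hψsym σ / ∑ σ' : V → Q, gibbsWeight G φ ψ hψsym σ'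

/-- Distance `|x − y| ∈ [0,∞]` on `ℝ ∪ {−∞}`: `0` if both are `−∞`, `∞` if exactly one is. -/
noncomputable def dB (x y : WithBot ℝ) : ℝ≥0∞ :=
  WithBot.recBotCoe (WithBot.recBotCoe (0 : ℝ≥0∞) (fun _ => (⊤ : ℝ≥0∞)) y)
    (fun r => WithBot.recBotCoe (⊤ : ℝ≥0∞) (fun s => ENNReal.ofReal |r - s|) y) x

/-- The contribution of vertex `v` to the Hamiltonian distance:
`‖φ_v − φ'_v‖₁ + Σ_{e = {u,v} ∈ E} ‖φ_e − φ'_e‖₁`. -/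
noncomputable def dVert {V Q : Type*} [Fintype V] [Fintype Q]
    (G : SimpleGraph V) [DecidableRel G.Adj]
    (φ φ' : V → Q → WithBot ℝ) (ψ ψ' : V → V → Q → Q → WithBot ℝ) (v : V) : ℝ≥0∞ :=
  (∑ c, dB (φ v c) (φ' v c)) +
    ∑ u ∈ G.neighborFinset v, ∑ c, ∑ c', dB (ψ u v c c') (ψ' u v c c')

/-- Hamiltonian distance `d_Ham(I,I') = Σ_v ‖φ_v − φ'_v‖₁ + Σ_{e∈E} ‖φ_e − φ'_e‖₁`
(the edge sum is written as half the sum over ordered adjacent pairs). -/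
noncomputable def dHamiltonian {V Q : Type*} [Fintype V] [Fintype Q]
    (G : SimpleGraph V) [DecidableRel G.Adj]
    (φ φ' : V → Q → WithBot ℝ) (ψ ψ' : V → V → Q → Q → WithBot ℝ) : ℝ≥0∞ :=
  (∑ v, ∑ c, dB (φ v c) (φ' v c)) +
    2⁻¹ * ∑ u, ∑ v ∈ G.neighborFinset u, ∑ c, ∑ c', dB (ψ u v c c') (ψ' u v c c')

/-- The filter probability `p̂_v = min{2(‖φ_v − φ'_v‖₁ + Σ_{e∋v} ‖φ_e − φ'_e‖₁), 1}`. -/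
noncomputable def pHat {V Q : Type*} [Fintype V] [Fintype Q]
    (G : SimpleGraph V) [DecidableRel G.Adj]
    (φ φ' : V → Q → WithBot ℝ) (ψ ψ' : V → V → Q → Q → WithBot ℝ) (v : V) : ℝ :=
  (min (2 * dVert G φ φ' ψ ψ' v) 1).toReal

lemma tvDist_triangle {Q : Type*} [Fintype Q] (μ ν ρ : Q → ℝ) :
    tvDist μ ρ ≤ tvDist μ ν + tvDist ν ρ := by
  unfold tvDist
  rw [← mul_add, ← Finset.sum_add_distrib]
  gcongr with x
  exact abs_sub_le _ _ _

lemma tvDist_nonneg {Q : Type*} [Fintype Q] (μ ν : Q → ℝ) : 0 ≤ tvDist μ ν := by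
  unfold tvDist; positivity

lemma tvDist_self {Q : Type*} [Fintype Q] (μ : Q → ℝ) : tvDist μ μ = 0 := by
  simp [tvDist]

lemma one_sub_tvDist {Q : Type*} [Fintype Q] (μ ν : Q → ℝ)
    (hμ : ∑ c, μ c = 1) (hν : ∑ c, ν c = 1) :
    ∑ c, min (μ c) (ν c) = 1 - tvDist μ ν := by
  have h : ∀ c, min (μ c) (ν c) = 2⁻¹ * (μ c + ν c - |μ c - ν c|) := fun c => by
    rcases le_total (μ c) (ν c) with h | h
    · rw [min_eq_left h, abs_of_nonpos (sub_nonpos.2 h)]; ring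
    · rw [min_eq_right h, abs_of_nonneg (sub_nonneg.2 h)]; ring
  simp only [h, ← Finset.mul_sum, Finset.sum_sub_distrib, Finset.sum_add_distrib, hμ, hν, tvDist]
  ring

/-- Two distributions admit a coupling whose agreement probability is at least the common mass. -/
lemma exists_isCoupling_sum_min_le {Q : Type*} [Fintype Q] (μ ν : Q → ℝ)
    (hμ0 : ∀ c, 0 ≤ μ c) (hν0 : ∀ c, 0 ≤ ν c) (hμ : ∑ c, μ c = 1) (hν : ∑ c, ν c = 1) :
    ∃ D, IsCoupling μ ν D ∧ ∑ c, min (μ c) (ν c) ≤ ∑ c, D c c := by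
  classical
  set m : Q → ℝ := fun c => min (μ c) (ν c) with hm
  set s : ℝ := 1 - ∑ c, m c with hs
  have hmμ : ∀ c, 0 ≤ μ c - m c := fun c => sub_nonneg.2 (min_le_left _ _)
  have hmν : ∀ c, 0 ≤ ν c - m c := fun c => sub_nonneg.2 (min_le_right _ _)
  have hsμ : ∑ c, (μ c - m c) = s := by rw [Finset.sum_sub_distrib, hμ]
  have hsν : ∑ c, (ν c - m c) = s := by rw [Finset.sum_sub_distrib, hν]
  have hs0 : 0 ≤ s := hsμ ▸ Finset.sum_nonneg fun c _ => hmμ c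
  have key : ∀ f : Q → ℝ, (∀ c, 0 ≤ f c) → ∑ c, f c = s → ∀ c, f c * s / s = f c := by
    intro f hf0 hf c
    by_cases h : s = 0
    · have : f c = 0 := (Finset.sum_eq_zero_iff_of_nonneg fun c _ => hf0 c).1 (hf.trans h) c
        (Finset.mem_univ c)
      simp [this]
    · field_simp
  refine ⟨fun c c' => (if c = c' then m c else 0) + (μ c - m c) * (ν c' - m c') / s,
    ⟨fun c c' => ?_, fun c => ?_, fun c' => ?_⟩, ?_⟩
  · have h1 : 0 ≤ m c := le_min (hμ0 c) (hν0 c)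
    have h2 := div_nonneg (mul_nonneg (hmμ c) (hmν c')) hs0
    dsimp only
    split_ifs <;> linarith
  · rw [Finset.sum_add_distrib, ← Finset.sum_div, ← Finset.mul_sum, hsν, key _ hmμ hsμ]
    simp
  · rw [Finset.sum_add_distrib, ← Finset.sum_div, ← Finset.sum_mul, hsμ, mul_comm s,
      key _ hmν hsν]
    simp
  · refine Finset.sum_le_sum fun c _ => ?_
    have h2 := div_nonneg (mul_nonneg (hmμ c) (hmν c)) hs0
    simp only [if_true]
    linarith

lemma IsOptimalCoupling.one_sub_sum_diag_le {Q : Type*} [Fintype Q] {μ ν : Q → ℝ}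
    {D : Q → Q → ℝ} (h : IsOptimalCoupling μ ν D)
    (hμ0 : ∀ c, 0 ≤ μ c) (hν0 : ∀ c, 0 ≤ ν c) (hμ : ∑ c, μ c = 1) (hν : ∑ c, ν c = 1) :
    1 - ∑ c, D c c ≤ tvDist μ ν := by
  obtain ⟨D', hD', hle⟩ := exists_isCoupling_sum_min_le μ ν hμ0 hν0 hμ hν
  have := h.2 D' hD'
  rw [one_sub_tvDist μ ν hμ hν] at hle
  linarith

lemma expB_nonneg (x : WithBot ℝ) : 0 ≤ expB x := by
  induction x using WithBot.recBotCoe with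
  | bot => exact le_rfl
  | coe a => exact (Real.exp_pos a).le

section Marginals

variable {V Q : Type*} [Fintype V] [Fintype Q] (G : SimpleGraph V) [DecidableRel G.Adj]
  (φ : V → Q → WithBot ℝ) (ψ : V → V → Q → Q → WithBot ℝ)

lemma margW_nonneg (v : V) (τ : V → Q) (c : Q) : 0 ≤ margW G φ ψ v τ c :=
  div_nonneg (expB_nonneg _) (Finset.sum_nonneg fun _ _ => expB_nonneg _)

lemma sum_margW (v : V) (τ : V → Q)
    (hpos : 0 < ∑ a, expB (φ v a + ∑ u ∈ G.neighborFinset v, ψ u v (τ u) a)) :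
    ∑ c, margW G φ ψ v τ c = 1 := by
  unfold margW
  rw [← Finset.sum_div, div_self hpos.ne']

lemma margW_congr {v : V} {σ τ : V → Q} (h : ∀ u, G.Adj v u → σ u = τ u) :
    margW G φ ψ v σ = margW G φ ψ v τ := by
  have key : ∀ a, ∑ u ∈ G.neighborFinset v, ψ u v (σ u) a =
      ∑ u ∈ G.neighborFinset v, ψ u v (τ u) a := fun a =>
    Finset.sum_congr rfl fun u hu => by rw [h u ((G.mem_neighborFinset v u).1 hu)]
  funext c
  simp only [margW, key]

lemma margW_eq_of_not_inS (G' : SimpleGraph V) [DecidableRel G'.Adj]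
    (ψ' : V → V → Q → Q → WithBot ℝ)
    (hagree : ∀ u v, G.Adj u v → G'.Adj u v → ∀ c c', ψ u v c c' = ψ' u v c c')
    {v : V} (hv : ¬ inS G G' v) : margW G φ ψ v = margW G' φ ψ' v := by
  simp only [inS, not_exists, not_or, not_and, not_not] at hv
  have hN : G.neighborFinset v = G'.neighborFinset v := by
    ext u
    rw [SimpleGraph.mem_neighborFinset, SimpleGraph.mem_neighborFinset]
    exact ⟨(hv u).1, (hv u).2⟩
  funext τ c
  have key : ∀ a, ∑ u ∈ G.neighborFinset v, ψ u v (τ u) a =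
      ∑ u ∈ G'.neighborFinset v, ψ' u v (τ u) a := fun a => by
    rw [← hN]
    refine Finset.sum_congr rfl fun u hu => ?_
    have hu := (G.mem_neighborFinset v u).1 hu
    exact hagree u v hu.symm ((hv u).1 hu).symm _ _
  simp only [margW, key]

lemma influence_nonneg (u v : V) : 0 ≤ influence G φ ψ u v := by
  unfold influence
  split_ifs
  · refine Real.sSup_nonneg ?_
    rintro d ⟨σ, τ, -, rfl⟩
    exact tvDist_nonneg _ _
  · exact le_rfl

lemma tvDist_margW_le_influence (u v : V) (σ τ : V → Q) (h : ∀ w, w ≠ u → σ w = τ w) :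
    tvDist (margW G φ ψ v σ) (margW G φ ψ v τ) ≤ influence G φ ψ u v := by
  classical
  unfold influence
  split_ifs with huv
  · refine le_csSup (Set.Finite.bddAbove ?_) ⟨σ, τ, h, rfl⟩
    refine (Set.finite_range fun p : (V → Q) × (V → Q) =>
      tvDist (margW G φ ψ v p.1) (margW G φ ψ v p.2)).subset ?_
    rintro d ⟨σ, τ, -, rfl⟩
    exact ⟨(σ, τ), rfl⟩
  · rw [margW_congr G φ ψ (σ := σ) (τ := τ), tvDist_self]
    intro w hw
    exact h w fun e => huv (e ▸ hw.symm)

lemma tvDist_margW_le_sum_influence [DecidableEq V] (v : V) (s : Finset V) (σ τ : V → Q)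
    (h : ∀ w, w ∉ s → σ w = τ w) :
    tvDist (margW G φ ψ v σ) (margW G φ ψ v τ) ≤ ∑ u ∈ s, influence G φ ψ u v := by
  induction s using Finset.induction_on generalizing σ with
  | empty =>
    rw [funext fun w => h w (Finset.notMem_empty w), tvDist_self, Finset.sum_empty]
  | insert a s ha ih =>
    rw [Finset.sum_insert ha]
    refine (tvDist_triangle _ (margW G φ ψ v (Function.update σ a (τ a))) _).trans
      (add_le_add (tvDist_margW_le_influence G φ ψ a v _ _ fun w hw => ?_) (ih _ fun w hw => ?_))
    · rw [Function.update_of_ne hw]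
    · by_cases hwa : w = a
      · subst hwa; simp
      · rw [Function.update_of_ne hwa]
        exact h w (by simp [hwa, hw])

end Marginals

/-- The number of vertices on which the two coordinates of a pair state disagree. -/
def disagreement {V Q : Type*} [Fintype V] [DecidableEq Q] (p : (V → Q) × (V → Q)) : ℝ :=
  ∑ u, if p.1 u ≠ p.2 u then 1 else 0

lemma disagreement_nonneg {V Q : Type*} [Fintype V] [DecidableEq Q] (p : (V → Q) × (V → Q)) :
    0 ≤ disagreement p :=
  Finset.sum_nonneg fun _ _ => by split_ifs <;> norm_num

lemma disagreement_update {V Q : Type*} [Fintype V] [DecidableEq V] [DecidableEq Q]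
    (σ τ : V → Q) (v : V) (c c' : Q) :
    disagreement (Function.update σ v c, Function.update τ v c') =
      disagreement (σ, τ) - (if σ v ≠ τ v then 1 else 0) + (if c ≠ c' then 1 else 0) := by
  simp only [disagreement]
  rw [← Finset.add_sum_erase _ _ (Finset.mem_univ v), ← Finset.add_sum_erase _ _ (Finset.mem_univ v)]
  have : ∀ u ∈ Finset.univ.erase v,
      (if Function.update σ v c u ≠ Function.update τ v c' u then (1 : ℝ) else 0) =
        if σ u ≠ τ u then 1 else 0 := fun u hu => by
    have hu := Finset.ne_of_mem_erase hu
    rw [Function.update_of_ne hu, Function.update_of_ne hu]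
  rw [Finset.sum_congr rfl this]
  simp only [Function.update_self]
  ring

lemma sum_pairKernel_mul {V Q : Type*} [Fintype V] [DecidableEq V] [Fintype Q]
    (Dloc : V → (V → Q) → (V → Q) → Q → Q → ℝ) (p : (V → Q) × (V → Q))
    (f : (V → Q) × (V → Q) → ℝ) :
    ∑ p', pairKernel Dloc p p' * f p' = (Fintype.card V : ℝ)⁻¹ * ∑ v, ∑ c, ∑ c',
      Dloc v p.1 p.2 c c' * f (Function.update p.1 v c, Function.update p.2 v c') := by
  classical
  simp only [pairKernel, mul_assoc, ← Finset.mul_sum, Finset.sum_mul]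
  rw [Finset.sum_comm]
  congr 1
  refine Finset.sum_congr rfl fun v _ => ?_
  simp only [ite_mul, zero_mul]
  rw [← Finset.sum_filter, ← Fintype.sum_prod_type' (f := fun c c' => Dloc v p.1 p.2 c c' *
    f (Function.update p.1 v c, Function.update p.2 v c'))]
  symm
  refine Finset.sum_bij' (fun q _ => (Function.update p.1 v q.1, Function.update p.2 v q.2))
    (fun p' _ => (p'.1 v, p'.2 v)) ?_ ?_ ?_ ?_ ?_
  · intro q _
    simp only [Finset.mem_filter, Finset.mem_univ, true_and]
    exact ⟨fun u hu => Function.update_of_ne hu _ _, fun u hu => Function.update_of_ne hu _ _⟩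
  · simp
  · simp
  · intro p' hp'
    obtain ⟨h1, h2⟩ := (Finset.mem_filter.1 hp').2
    refine Prod.ext (funext fun u => ?_) (funext fun u => ?_) <;>
    · by_cases hu : u = v
      · subst hu; simp
      · simp [Function.update_of_ne hu, h1 u hu, h2 u hu]
  · simp

section Drift

variable {S : Type*} [Fintype S] {P : S → S → ℝ} {μ₀ : S → ℝ}

lemma chainDist_nonneg (hP : ∀ s s', 0 ≤ P s s') (hμ : ∀ s, 0 ≤ μ₀ s) (t : ℕ) (s : S) :
    0 ≤ chainDist P μ₀ t s := by
  induction t generalizing s with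
  | zero => exact hμ s
  | succ t ih => exact Finset.sum_nonneg fun s' _ => mul_nonneg (ih s') (hP _ _)

lemma sum_chainDist_succ_mul (f : S → ℝ) (t : ℕ) :
    ∑ s, chainDist P μ₀ (t + 1) s * f s = ∑ s, chainDist P μ₀ t s * ∑ s', P s s' * f s' := by
  simp only [chainDist, Finset.sum_mul, Finset.mul_sum]
  rw [Finset.sum_comm]
  simp only [mul_assoc]

lemma sum_chainDist (hP : ∀ s, ∑ s', P s s' = 1) (hμ : ∑ s, μ₀ s = 1) (t : ℕ) :
    ∑ s, chainDist P μ₀ t s = 1 := by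
  induction t with
  | zero => exact hμ
  | succ t ih =>
    have := sum_chainDist_succ_mul (P := P) (μ₀ := μ₀) (fun _ => 1) t
    simpa [hP, ih] using this

/-- A geometric drift bound keeps the expectation of `f` below the fixed point of the drift. -/
lemma sum_chainDist_mul_le_of_drift (hP0 : ∀ s s', 0 ≤ P s s') (hP : ∀ s, ∑ s', P s s' = 1)
    (hμ0 : ∀ s, 0 ≤ μ₀ s) (hμ : ∑ s, μ₀ s = 1) (f : S → ℝ) (a b B : ℝ) (ha : 0 ≤ a)
    (hdrift : ∀ s, ∑ s', P s s' * f s' ≤ a * f s + b) (hB : a * B + b ≤ B)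
    (h0 : ∑ s, μ₀ s * f s ≤ B) (t : ℕ) :
    ∑ s, chainDist P μ₀ t s * f s ≤ B := by
  induction t with
  | zero => exact h0
  | succ t ih =>
    rw [sum_chainDist_succ_mul]
    calc ∑ s, chainDist P μ₀ t s * ∑ s', P s s' * f s'
        ≤ ∑ s, chainDist P μ₀ t s * (a * f s + b) := by
          gcongr with s
          · exact chainDist_nonneg hP0 hμ0 t s
          · exact hdrift s
      _ = a * ∑ s, chainDist P μ₀ t s * f s + b * ∑ s, chainDist P μ₀ t s := by
          rw [Finset.mul_sum, Finset.mul_sum, ← Finset.sum_add_distrib]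
          exact Finset.sum_congr rfl fun s _ => by ring
      _ ≤ a * B + b := by
          rw [sum_chainDist hP hμ, mul_one]
          gcongr
      _ ≤ B := hB

end Drift

open Classical in
/-- At most two vertices per changed edge are incident to a changed edge. -/
lemma sum_inS_le {V : Type*} [Fintype V] (G G' : SimpleGraph V)
    [Fintype G.edgeSet] [Fintype G'.edgeSet] [DecidableEq (Sym2 V)] :
    ∑ v, (if inS G G' v then (1 : ℝ) else 0) ≤
      2 * ((symmDiff G.edgeFinset G'.edgeFinset).card : ℝ) := by
  rw [Finset.sum_boole]
  have hsub : Finset.univ.filter (inS G G') ⊆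
      (symmDiff G.edgeFinset G'.edgeFinset).biUnion Sym2.toFinset := by
    intro v hv
    obtain ⟨u, hu⟩ := (Finset.mem_filter.1 hv).2
    refine Finset.mem_biUnion.2 ⟨s(v, u), ?_, by simp⟩
    simpa [Finset.mem_symmDiff] using hu
  have hcard : (Finset.univ.filter (inS G G')).card ≤
      (symmDiff G.edgeFinset G'.edgeFinset).card * 2 :=
    (Finset.card_le_card hsub).trans (Finset.card_biUnion_le_card_mul _ _ _ fun e _ => by
      rw [Sym2.card_toFinset]; split_ifs <;> norm_num)
  rw [mul_comm]
  exact_mod_cast hcard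

open Classical in
lemma sum_indSnbr_le {V Q : Type*} [Fintype V] [DecidableEq Q] (G G' : SimpleGraph V)
    [DecidableRel G.Adj] (p : (V → Q) × (V → Q)) :
    ∑ v, indSnbr G G' p v ≤
      ∑ v, (if inS G G' v then (1 : ℝ) else 0) + (G.maxDegree + 1) * disagreement p := by
  have hv : ∀ v, indSnbr G G' p v ≤ (if inS G G' v then (1 : ℝ) else 0) +
      ∑ u, (if p.1 u ≠ p.2 u then 1 else 0) * (if u = v ∨ G.Adj v u then 1 else 0) := by
    intro v
    have hnn : ∀ u ∈ Finset.univ, (0 : ℝ) ≤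
        (if p.1 u ≠ p.2 u then 1 else 0) * (if u = v ∨ G.Adj v u then 1 else 0) :=
      fun u _ => mul_nonneg (by split_ifs <;> norm_num) (by split_ifs <;> norm_num)
    have hnn' := Finset.sum_nonneg hnn
    unfold indSnbr
    split_ifs with h1 h2 h2
    · linarith
    · obtain ⟨u, hu, hpu⟩ := h1.resolve_left h2
      have := Finset.single_le_sum hnn (Finset.mem_univ u)
      rw [if_pos hpu, if_pos hu] at this
      linarith
    · exact absurd (Or.inl h2) h1
    · linarith
  refine (Finset.sum_le_sum fun v _ => hv v).trans ?_
  rw [Finset.sum_add_distrib]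
  gcongr
  rw [Finset.sum_comm, disagreement, Finset.mul_sum]
  refine Finset.sum_le_sum fun u _ => ?_
  rw [← Finset.mul_sum, mul_comm]
  refine mul_le_mul_of_nonneg_right ?_ (by split_ifs <;> norm_num)
  rw [Finset.sum_boole]
  have : (Finset.univ.filter fun v => u = v ∨ G.Adj v u) ⊆ insert u (G.neighborFinset u) := by
    intro v hv
    rcases (Finset.mem_filter.1 hv).2 with h | h
    · simp [h]
    · simp [h.symm]
  have hc := (Finset.card_le_card this).trans (Finset.card_insert_le _ _)
  rw [G.card_neighborFinset_eq_degree] at hc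
  exact_mod_cast hc.trans (Nat.add_le_add_right (G.degree_le_maxDegree u) 1)

/-- If every local coupling is a probability distribution, one step of the pair chain replaces
the disagreement at the chosen vertex by the local disagreement probability. -/
lemma sum_pairKernel_mul_disagreement {V Q : Type*} [Fintype V] [DecidableEq V] [Nonempty V]
    [Fintype Q] [DecidableEq Q] (Dloc : V → (V → Q) → (V → Q) → Q → Q → ℝ)
    (hsum : ∀ v σ τ, ∑ c, ∑ c', Dloc v σ τ c c' = 1) (p : (V → Q) × (V → Q)) :
    ∑ p', pairKernel Dloc p p' * disagreement p' = disagreement p +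
      (Fintype.card V : ℝ)⁻¹ *
        (∑ v, (1 - ∑ c, Dloc v p.1 p.2 c c) - disagreement p) := by
  have hv : ∀ v, ∑ c, ∑ c', Dloc v p.1 p.2 c c' *
      disagreement (Function.update p.1 v c, Function.update p.2 v c') =
      disagreement p - (if p.1 v ≠ p.2 v then 1 else 0) + (1 - ∑ c, Dloc v p.1 p.2 c c) := by
    intro v
    have h : ∀ c c', Dloc v p.1 p.2 c c' *
        disagreement (Function.update p.1 v c, Function.update p.2 v c') =
        Dloc v p.1 p.2 c c' * (disagreement p - (if p.1 v ≠ p.2 v then 1 else 0) + 1) -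
          (if c = c' then Dloc v p.1 p.2 c c' else 0) := by
      intro c c'
      rw [disagreement_update]
      by_cases hc : c = c' <;> simp [hc]; ring
    simp only [h, Finset.sum_sub_distrib, ← Finset.sum_mul, hsum]
    simp
    ring
  rw [sum_pairKernel_mul]
  simp only [hv, Finset.sum_add_distrib, Finset.sum_sub_distrib (f := fun _ : V => disagreement p)]
  have hn : (Fintype.card V : ℝ) ≠ 0 := by exact_mod_cast Fintype.card_ne_zero
  rw [show ∑ v, (if p.1 v ≠ p.2 v then (1 : ℝ) else 0) = disagreement p from rfl]
  rw [Finset.sum_const, Finset.card_univ, nsmul_eq_mul]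
  field_simp
  ring

/-- For the one-step local coupling for edge update run for `T` steps from
`X_0 = Y_0`, with `S` the set of vertices incident to changed edges and
`R_gra = Σ_{t=1}^T 1{v_t ∈ S ∪ Γ_G⁺(D_{t−1})}`, if `I'` satisfies the Dobrushin–Shlosman
condition with constant `δ ∈ (0,1]` and `|E ⊕ E'| ≤ L`, then
`E[R_gra] ≤ 18·Δ·T·L/(δ·n)` where `Δ = max{Δ_G, Δ_{G'}} ≥ 1`.
The expectation is written in closed form: conditionally on the pair state at time `t−1`,
`Pr[v_t ∈ S ∪ Γ_G⁺(D_{t−1})] = n⁻¹ Σ_v 1{v ∈ S ∪ Γ_G⁺(D_{t−1})}`. -/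
theorem expected_R_gra_bound
    {V Q : Type*} [Fintype V] [DecidableEq V] [Nonempty V]
    [Fintype Q] [DecidableEq Q] [Nonempty Q]
    (G G' : SimpleGraph V) [DecidableRel G.Adj] [DecidableRel G'.Adj]
    [Fintype G.edgeSet] [Fintype G'.edgeSet]
    (φ : V → Q → WithBot ℝ) (ψ ψ' : V → V → Q → Q → WithBot ℝ)
    (hψsym : ∀ u v c c', ψ u v c c' = ψ v u c' c)
    (hψ'sym : ∀ u v c c', ψ' u v c c' = ψ' v u c' c)
    (hQ2 : 2 ≤ Fintype.card Q)
    (hagree : ∀ u v, G.Adj u v → G'.Adj u v → ∀ c c', ψ u v c c' = ψ' u v c c')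
    (hpos : ∀ (v : V) (τ : V → Q),
      0 < ∑ a, expB (φ v a + ∑ u ∈ G.neighborFinset v, ψ u v (τ u) a))
    (hpos' : ∀ (v : V) (τ : V → Q),
      0 < ∑ a, expB (φ v a + ∑ u ∈ G'.neighborFinset v, ψ' u v (τ u) a))
    (δ L : ℝ) (T : ℕ) (hδ0 : 0 < δ) (hδ1 : δ ≤ 1)
    (hΔ : 1 ≤ max G.maxDegree G'.maxDegree)
    (hDob' : DobrushinCondition G' φ ψ' δ)
    (hL : ((symmDiff G.edgeFinset G'.edgeFinset).card : ℝ) ≤ L)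
    (Dloc : V → (V → Q) → (V → Q) → Q → Q → ℝ)
    (hS : ∀ (v : V) (σ τ : V → Q), inS G G' v →
      ∀ c c', Dloc v σ τ c c' = margW G φ ψ v σ c * margW G' φ ψ' v τ c')
    (hOpt : ∀ (v : V) (σ τ : V → Q), ¬ inS G G' v →
      IsOptimalCoupling (margW G φ ψ v σ) (margW G φ ψ v τ) (Dloc v σ τ))
    (σ0 : V → Q) :
    ∑ t ∈ Finset.range T,
        ∑ p : (V → Q) × (V → Q),
          chainDist (pairKernel Dloc) (initDelta (σ0, σ0)) t p *
          ((Fintype.card V : ℝ)⁻¹ * ∑ v, indSnbr G G' p v)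
      ≤ 18 * (max G.maxDegree G'.maxDegree : ℝ) * T * L / (δ * (Fintype.card V : ℝ)) := by
  classical
  set n : ℝ := (Fintype.card V : ℝ) with hn_def
  set Δ : ℝ := max (G.maxDegree : ℝ) (G'.maxDegree : ℝ) with hΔ_def
  have hn1 : 1 ≤ n := Nat.one_le_cast.2 Fintype.card_pos
  have hn0 : 0 < n := by linarith
  have hΔ1 : (1 : ℝ) ≤ Δ := by
    rw [hΔ_def]; exact_mod_cast hΔ
  have hL0 : 0 ≤ L := le_trans (Nat.cast_nonneg _) hL
  have hSL : ∑ v, (if inS G G' v then (1 : ℝ) else 0) ≤ 2 * L :=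
    (sum_inS_le G G').trans (by gcongr)
  have hm := fun v τ => sum_margW G φ ψ v τ (hpos v τ)
  have hm' := fun v τ => sum_margW G' φ ψ' v τ (hpos' v τ)
  have hD0 : ∀ v σ τ c c', 0 ≤ Dloc v σ τ c c' := by
    intro v σ τ c c'
    by_cases hv : inS G G' v
    · rw [hS v σ τ hv]
      exact mul_nonneg (margW_nonneg _ _ _ _ _ _) (margW_nonneg _ _ _ _ _ _)
    · exact (hOpt v σ τ hv).1.1 c c'
  have hD1 : ∀ v σ τ, ∑ c, ∑ c', Dloc v σ τ c c' = 1 := by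
    intro v σ τ
    by_cases hv : inS G G' v
    · simp only [hS v σ τ hv, ← Finset.mul_sum, hm', mul_one, hm]
    · simp only [(hOpt v σ τ hv).1.2.1, hm]
  have hP0 : ∀ p p', 0 ≤ pairKernel Dloc p p' := by
    intro p p'
    unfold pairKernel
    refine mul_nonneg (inv_nonneg.2 hn0.le) (Finset.sum_nonneg fun v _ => ?_)
    split_ifs
    · exact hD0 _ _ _ _ _
    · exact le_rfl
  have hP1 : ∀ p, ∑ p', pairKernel Dloc p p' = 1 := by
    intro p
    have := sum_pairKernel_mul Dloc p fun _ => 1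
    simp only [mul_one, hD1] at this
    rw [this, Finset.sum_const, Finset.card_univ, nsmul_eq_mul, mul_one, inv_mul_cancel₀ hn0.ne']
  have hi0 : ∀ p : (V → Q) × (V → Q), 0 ≤ initDelta (σ0, σ0) p := by
    intro p; unfold initDelta; split_ifs <;> norm_num
  have hi1 : ∑ p : (V → Q) × (V → Q), initDelta (σ0, σ0) p = 1 := by simp [initDelta]
  have hlocal : ∀ (p : (V → Q) × (V → Q)) v, 1 - ∑ c, Dloc v p.1 p.2 c c ≤
      (if inS G G' v then (1 : ℝ) else 0) +
        ∑ u, (if p.1 u ≠ p.2 u then 1 else 0) * influence G' φ ψ' u v := by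
    intro p v
    by_cases hv : inS G G' v
    · have h1 : 0 ≤ ∑ c, Dloc v p.1 p.2 c c := Finset.sum_nonneg fun c _ => hD0 _ _ _ _ _
      have h2 : 0 ≤ ∑ u, (if p.1 u ≠ p.2 u then 1 else 0) * influence G' φ ψ' u v :=
        Finset.sum_nonneg fun u _ =>
          mul_nonneg (by split_ifs <;> norm_num) (influence_nonneg _ _ _ _ _)
      rw [if_pos hv]
      linarith
    · have h1 := (hOpt v p.1 p.2 hv).one_sub_sum_diag_le (margW_nonneg _ _ _ _ _)
        (margW_nonneg _ _ _ _ _) (hm _ _) (hm _ _)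
      rw [margW_eq_of_not_inS G φ ψ G' ψ' hagree hv] at h1
      have h2 := tvDist_margW_le_sum_influence G' φ ψ' v
        (Finset.univ.filter fun u => p.1 u ≠ p.2 u) p.1 p.2 (by simp)
      rw [Finset.sum_filter] at h2
      rw [if_neg hv, zero_add]
      simpa only [ite_mul, one_mul, zero_mul] using h1.trans h2
  have hdrift : ∀ p, ∑ p', pairKernel Dloc p p' * disagreement p' ≤
      (1 - δ / n) * disagreement p + 2 * L / n := by
    intro p
    have hsum : ∑ v, (1 - ∑ c, Dloc v p.1 p.2 c c) ≤ 2 * L + (1 - δ) * disagreement p := by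
      refine (Finset.sum_le_sum fun v _ => hlocal p v).trans ?_
      rw [Finset.sum_add_distrib]
      refine add_le_add hSL ?_
      rw [Finset.sum_comm, disagreement, Finset.mul_sum]
      refine Finset.sum_le_sum fun u _ => ?_
      rw [← Finset.mul_sum, mul_comm]
      exact mul_le_mul_of_nonneg_right (hDob' u) (by split_ifs <;> norm_num)
    rw [sum_pairKernel_mul_disagreement Dloc hD1]
    calc disagreement p + n⁻¹ * (∑ v, (1 - ∑ c, Dloc v p.1 p.2 c c) - disagreement p)
        ≤ disagreement p + n⁻¹ * (2 * L + (1 - δ) * disagreement p - disagreement p) := by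
          gcongr
      _ = (1 - δ / n) * disagreement p + 2 * L / n := by
          field_simp
          ring
  have hdis : ∀ t, ∑ p, chainDist (pairKernel Dloc) (initDelta (σ0, σ0)) t p * disagreement p ≤
      2 * L / δ := by
    refine sum_chainDist_mul_le_of_drift hP0 hP1 hi0 hi1 _ (1 - δ / n) (2 * L / n) _ ?_ hdrift ?_ ?_
    · rw [sub_nonneg, div_le_one hn0]
      linarith
    · apply le_of_eq
      field_simp
      ring
    · simp only [initDelta, ite_mul, one_mul, zero_mul, Finset.sum_ite_eq', Finset.mem_univ,
        if_true]
      simp only [disagreement, ne_eq, not_true_eq_false, if_false, Finset.sum_const_zero]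
      positivity
  have hstep : ∀ t, ∑ p : (V → Q) × (V → Q),
      chainDist (pairKernel Dloc) (initDelta (σ0, σ0)) t p * (n⁻¹ * ∑ v, indSnbr G G' p v) ≤
      18 * Δ * L / (δ * n) := by
    intro t
    calc _ ≤ ∑ p : (V → Q) × (V → Q), chainDist (pairKernel Dloc) (initDelta (σ0, σ0)) t p *
          (n⁻¹ * (2 * L + 2 * Δ * disagreement p)) := by
          refine Finset.sum_le_sum fun p _ => mul_le_mul_of_nonneg_left
            (mul_le_mul_of_nonneg_left ?_ (inv_nonneg.2 hn0.le)) (chainDist_nonneg hP0 hi0 t p)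
          refine (sum_indSnbr_le G G' p).trans (add_le_add hSL ?_)
          refine mul_le_mul_of_nonneg_right ?_ (disagreement_nonneg p)
          have : (G.maxDegree : ℝ) ≤ Δ := le_max_left _ _
          linarith
      _ = n⁻¹ * (2 * L * ∑ p, chainDist (pairKernel Dloc) (initDelta (σ0, σ0)) t p + 2 * Δ *
          ∑ p, chainDist (pairKernel Dloc) (initDelta (σ0, σ0)) t p * disagreement p) := by
          rw [Finset.mul_sum, Finset.mul_sum, ← Finset.sum_add_distrib, Finset.mul_sum]
          exact Finset.sum_congr rfl fun p _ => by ring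
      _ ≤ n⁻¹ * (2 * L * 1 + 2 * Δ * (2 * L / δ)) := by
          rw [sum_chainDist hP1 hi1]
          gcongr
          exact hdis t
      _ = (2 * (δ * L) + 4 * (Δ * L)) / (δ * n) := by
          field_simp
          ring
      _ ≤ 18 * Δ * L / (δ * n) := by
          gcongr
          have h1 : δ * L ≤ Δ * L := mul_le_mul_of_nonneg_right (hδ1.trans hΔ1) hL0
          have h2 : 0 ≤ Δ * L := by positivity
          linarith
  calc _ ≤ ∑ _t ∈ Finset.range T, 18 * Δ * L / (δ * n) := Finset.sum_le_sum fun t _ => hstep t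
    _ = 18 * Δ * T * L / (δ * n) := by
        rw [Finset.sum_const, Finset.card_range, nsmul_eq_mul]
        ring
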